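/- arXiv:2602.05019 — 9 statements merged into one kernel-verified Lean document; each statement's English description precedes it below -/
import Mathlib

section
/- Fix a positive integer K, a real number γ > 0, and a vector v̂ ∈ ℝ^K. Let λ ∈ [1, K] be a real number satisfying Σ_{a=1}^{K} 1/(λ + 2γ(v̂(a) − min_b v̂(b))) = 1, and define p(a) = 1/(λ + 2γ(v̂(a) − min_b v̂(b))) for each a ∈ [K]. Then for every vector v ∈ ℝ^K and every probability vector μ ∈ Δ_K, it holds that Σ_{a=1}^{K} v(a) p(a) − Σ_{a=1}^{K} v(a) μ(a) ≤ K/(2γ) + γ Σ_{a=1}^{K} p(a) (v̂(a) − v(a))². -/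
/-- Coordinatewise form of the inequality: inverse gap weighting at a single action with weight
`1 / D`, where `D = l + 2γ(w - m)`. -/
lemma inverse_gap_weighting_coordinate_le {γ D l w m x u : ℝ} (hγ : 0 < γ) (hD : 0 < D)
    (h : D = l + 2 * γ * (w - m)) (hu0 : 0 ≤ u) (hu1 : u ≤ 1) :
    x * (1 / D) - x * u ≤ 1 / (2 * γ) + γ * (1 / D * (w - x) ^ 2)
      + (m - l / (2 * γ) + 1 / (4 * γ)) * (1 / D - u) := by
  have hw : w = m + (D - l) / (2 * γ) := by
    field_simp
    linarith
  have key : 1 / (2 * γ) + γ * (1 / D * (w - x) ^ 2)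
      + (m - l / (2 * γ) + 1 / (4 * γ)) * (1 / D - u) - (x * (1 / D) - x * u)
      = (2 * γ * (x - w) - (1 - u * D)) ^ 2 / (4 * γ * D)
        + (u * D + u * D * (1 - u) + u) / (4 * γ) := by
    rw [hw]
    field_simp
    ring
  have hu : 0 ≤ 1 - u := sub_nonneg.mpr hu1
  have : 0 ≤ (2 * γ * (x - w) - (1 - u * D)) ^ 2 / (4 * γ * D)
      + (u * D + u * D * (1 - u) + u) / (4 * γ) := by positivity
  linarith


/-- The key SquareCB inequality: for the Inverse Gap Weighting distribution
`p a = 1 / (λ + 2γ(v̂ a − min_b v̂ b))` with normalizer `λ ∈ [1, K]`, any vector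
`v ∈ ℝ^K` and any probability vector `μ ∈ Δ_K`,
`⟨v, p⟩ − ⟨v, μ⟩ ≤ K/(2γ) + γ ∑_a p a (v̂ a − v a)²`. -/
theorem squareCB_inequality
    (K : ℕ) (hK : 0 < K) (γ : ℝ) (hγ : 0 < γ)
    (vhat : Fin K → ℝ) (m : ℝ) (hm : IsLeast (Set.range vhat) m)
    (lam : ℝ) (hlam : lam ∈ Set.Icc (1 : ℝ) (K : ℝ))
    (p : Fin K → ℝ) (hp : ∀ a, p a = 1 / (lam + 2 * γ * (vhat a - m)))
    (hpsum : ∑ a : Fin K, p a = 1)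
    (v μ : Fin K → ℝ) (hμ0 : ∀ a, 0 ≤ μ a) (hμ1 : ∑ a : Fin K, μ a = 1) :
    (∑ a : Fin K, v a * p a) - (∑ a : Fin K, v a * μ a) ≤
      (K : ℝ) / (2 * γ) + γ * ∑ a : Fin K, p a * (vhat a - v a) ^ 2 := by
  have hpos : ∀ a, 0 < lam + 2 * γ * (vhat a - m) := fun a => by
    have hgap : 0 ≤ vhat a - m := sub_nonneg.mpr (hm.2 ⟨a, rfl⟩)
    have hl : 0 < lam := lt_of_lt_of_le one_pos hlam.1
    positivity
  have hμle : ∀ a, μ a ≤ 1 := fun a =>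
    hμ1 ▸ Finset.single_le_sum (fun b _ => hμ0 b) (Finset.mem_univ a)
  have hsum := Finset.sum_le_sum fun a (_ : a ∈ Finset.univ) =>
    inverse_gap_weighting_coordinate_le (x := v a) hγ (hpos a) rfl (hμ0 a) (hμle a)
  simp only [← hp, Finset.sum_add_distrib, Finset.sum_sub_distrib, ← Finset.mul_sum, hpsum, hμ1,
    Finset.sum_const, Finset.card_univ, Fintype.card_fin, nsmul_eq_mul, sub_self, mul_zero,
    add_zero, mul_one_div] at hsum
  exact hsum
end

section
/- Let K be a positive integer, γ > 0 and β real numbers, and let f, g, f̂, ĝ ∈ ℝ^K. Define the target surrogate L(a) = f(a) − β·g(a) and the estimated surrogate L̂(a) = f̂(a) − β·ĝ(a) for a ∈ [K]. Let λ ∈ [1, K] satisfy Σ_{a=1}^{K} 1/(λ + 2γ(max_b L̂(b) − L̂(a))) = 1 and define p(a) = 1/(λ + 2γ(max_b L̂(b) − L̂(a))). Set z = max(1, β²). Then for every probability vector μ ∈ Δ_K: Σ_a L(a) μ(a) − Σ_a L(a) p(a) ≤ K/(2γ) + 2γ·( Σ_a p(a)(f̂(a) − f(a))² + z · Σ_a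 p(a)(ĝ(a) − g(a))² ). -/
/-- Expansion of the squared surrogate error into reward and cost errors. -/
theorem sq_sub_mul_le (x y β : ℝ) :
    (x - β * y) ^ 2 ≤ 2 * (x ^ 2 + max 1 (β ^ 2) * y ^ 2) := by
  have h : β ^ 2 * y ^ 2 ≤ max 1 (β ^ 2) * y ^ 2 := by gcongr; exact le_max_right _ _
  nlinarith [sq_nonneg (x + β * y)]

/-- Weighted Young inequality for the difference of two weights `q, m`, where `m ≤ 1` and
`w = 1 / q`. -/
theorem neg_mul_sub_le_young {γ q w m : ℝ} (hγ : 0 < γ) (hq : 0 < q) (hqw : q * w = 1)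
    (hm0 : 0 ≤ m) (hm1 : m ≤ 1) (e : ℝ) :
    -(e * (m - q)) ≤ γ * q * e ^ 2 + (m * w + q - 2 * m) / (4 * γ) := by
  have hw : 0 < w := pos_of_mul_pos_right (hqw ▸ one_pos) hq.le
  have hexp : w * (m - q + 2 * γ * q * e) ^ 2 =
      m ^ 2 * w + q - 2 * m + 4 * γ * e * (m - q) + 4 * γ ^ 2 * q * e ^ 2 := by
    linear_combination (-2 * m + q + 4 * γ * e * (m - q) + 4 * γ ^ 2 * q * e ^ 2) * hqw
  have hsq : 0 ≤ w * (m - q + 2 * γ * q * e) ^ 2 := by positivity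
  have hmw : m ^ 2 * w ≤ m * w := by
    gcongr
    nlinarith
  rw [← sub_le_iff_le_add', le_div_iff₀ (by positivity)]
  linarith

/-- Per-action form of the inverse gap weighting bound; the first summand on the right telescopes
to zero when `m` and `q` have the same total mass. -/
theorem igw_action_bound {γ q w m lam M l lhat : ℝ} (hγ : 0 < γ) (hq : 0 < q)
    (hqw : q * w = 1) (hw : w = lam + 2 * γ * (M - lhat)) (hm0 : 0 ≤ m) (hm1 : m ≤ 1) :
    l * m - l * q ≤ (M + lam / (2 * γ) - 1 / (4 * γ)) * (m - q) + 1 / (2 * γ) +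
      γ * (q * (lhat - l) ^ 2) := by
  have hyoung := neg_mul_sub_le_young hγ hq hqw hm0 hm1 (lhat - l)
  have hwpos : 0 < w := pos_of_mul_pos_right (hqw ▸ one_pos) hq.le
  have hlhat : lhat = M + lam / (2 * γ) - w / (2 * γ) := by
    rw [hw]; field_simp; ring
  have hslack : 0 ≤ (m * w + m) / (4 * γ) := by positivity
  have hexp : l * m - l * q = (M + lam / (2 * γ)) * (m - q) + 1 / (2 * γ) -
      m * w / (2 * γ) + -((lhat - l) * (m - q)) := by
    linear_combination (m - q) * hlhat + hqw / (2 * γ)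
  have hsplit : (m * w + q - 2 * m) / (4 * γ) =
      m * w / (2 * γ) - 1 / (4 * γ) * (m - q) - (m * w + m) / (4 * γ) := by
    field_simp; ring
  linarith


/-- One-step surrogate-reward regret bound for the IGW policy applied to the
estimated surrogate `L̂ a = f̂ a − β ĝ a`, against the target surrogate
`L a = f a − β g a`: for every probability vector `μ ∈ Δ_K`,
`⟨L, μ⟩ − ⟨L, p⟩ ≤ K/(2γ) + 2γ(∑_a p a (f̂ a − f a)² + z ∑_a p a (ĝ a − g a)²)`
where `z = max 1 β²`. -/
theorem surrogate_squareCB_inequality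
    (K : ℕ) (hK : 0 < K) (γ β : ℝ) (hγ : 0 < γ)
    (f g fhat ghat L Lhat : Fin K → ℝ)
    (hL : ∀ a, L a = f a - β * g a)
    (hLhat : ∀ a, Lhat a = fhat a - β * ghat a)
    (M : ℝ) (hM : IsGreatest (Set.range Lhat) M)
    (lam : ℝ) (hlam : lam ∈ Set.Icc (1 : ℝ) (K : ℝ))
    (p : Fin K → ℝ) (hp : ∀ a, p a = 1 / (lam + 2 * γ * (M - Lhat a)))
    (hpsum : ∑ a : Fin K, p a = 1)
    (z : ℝ) (hz : z = max 1 (β ^ 2))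
    (μ : Fin K → ℝ) (hμ0 : ∀ a, 0 ≤ μ a) (hμ1 : ∑ a : Fin K, μ a = 1) :
    (∑ a : Fin K, L a * μ a) - (∑ a : Fin K, L a * p a) ≤
      (K : ℝ) / (2 * γ) +
        2 * γ * ((∑ a : Fin K, p a * (fhat a - f a) ^ 2) +
          z * ∑ a : Fin K, p a * (ghat a - g a) ^ 2) := by
  have hden : ∀ a, 0 < lam + 2 * γ * (M - Lhat a) := fun a => by
    have := mul_nonneg hγ.le (sub_nonneg.2 (hM.2 (Set.mem_range_self a)))
    linarith [hlam.1]
  have hppos : ∀ a, 0 < p a := fun a => by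
    rw [hp]; exact one_div_pos.2 (hden a)
  have hμle : ∀ a, μ a ≤ 1 := fun a =>
    hμ1 ▸ Finset.single_le_sum (fun i _ => hμ0 i) (Finset.mem_univ a)
  have hterm : ∀ a, L a * μ a - L a * p a ≤
      (M + lam / (2 * γ) - 1 / (4 * γ)) * (μ a - p a) + 1 / (2 * γ) +
        2 * γ * (p a * (fhat a - f a) ^ 2 + z * (p a * (ghat a - g a) ^ 2)) := fun a => by
    have hpw : p a * (lam + 2 * γ * (M - Lhat a)) = 1 := by
      rw [hp, one_div_mul_cancel (hden a).ne']
    have hbound := igw_action_bound (l := L a) hγ (hppos a) hpw rfl (hμ0 a) (hμle a)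
    have herr : Lhat a - L a = (fhat a - f a) - β * (ghat a - g a) := by
      rw [hL, hLhat]; ring
    have hsq := mul_le_mul_of_nonneg_left (sq_sub_mul_le (fhat a - f a) (ghat a - g a) β)
      (mul_pos hγ (hppos a)).le
    rw [← herr, ← hz] at hsq
    linarith
  rw [← Finset.sum_sub_distrib]
  refine (Finset.sum_le_sum fun a _ => hterm a).trans_eq ?_
  simp only [Finset.sum_add_distrib, ← Finset.mul_sum, Finset.sum_sub_distrib, hμ1, hpsum,
    Finset.sum_const, Finset.card_univ, Fintype.card_fin, nsmul_eq_mul]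
  ring
end

section
/- Let T be a positive integer, K > 0 and U > 0 real numbers, z(1), …, z(T) real numbers with z(t) ≥ 1 for all t, and e_f(1), …, e_f(T), e_g(1), …, e_g(T) nonnegative real numbers with Σ_{t=1}^T e_f(t) ≤ U and Σ_{t=1}^T e_g(t) ≤ U. Define γ_t = (1/(2 z(t))) · √((K/U) · Σ_{τ=1}^{t} z(τ)) for each t. Then Σ_{t=1}^{T} [ K/(2γ_t) + 2γ_t ( e_f(t) + z(t)·e_g(t) ) ] ≤ 4·√( K · U · Σ_{t=1}^{T} z(t) ). -/
theorem div_sqrt_add_le_two_mul_sqrt_sub {a z : ℝ} (ha : 0 ≤ a) (hz : 0 ≤ z) :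
    z / √(a + z) ≤ 2 * √(a + z) - 2 * √a := by
  rcases (add_nonneg ha hz).eq_or_lt with h | h
  · obtain rfl : a = 0 := by linarith
    obtain rfl : z = 0 := by linarith
    simp
  · rw [div_le_iff₀ (Real.sqrt_pos.2 h)]
    nlinarith [sq_nonneg (√(a + z) - √a), Real.sq_sqrt ha, Real.sq_sqrt h.le]

theorem sum_div_sqrt_partialSum_le (T : ℕ) (z : ℕ → ℝ) (hz : ∀ t ∈ Finset.Icc 1 T, 0 ≤ z t) :
    ∑ t ∈ Finset.Icc 1 T, z t / √(∑ τ ∈ Finset.Icc 1 t, z τ) ≤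
      2 * √(∑ t ∈ Finset.Icc 1 T, z t) := by
  induction T with
  | zero => simp
  | succ n ih =>
    have hz' : ∀ t ∈ Finset.Icc 1 n, 0 ≤ z t := fun t ht =>
      hz t (Finset.Icc_subset_Icc_right n.le_succ ht)
    have hstep := div_sqrt_add_le_two_mul_sqrt_sub (Finset.sum_nonneg hz')
      (hz (n + 1) (by simp))
    rw [Finset.sum_Icc_succ_top (by omega), Finset.sum_Icc_succ_top (by omega)]
    linarith [ih hz']


/-- Telescoped surrogate-regret bound under the adaptive exploration schedule
`γ t = (1/(2 z t)) √((K/U) ∑_{τ≤t} z τ)`: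
`∑_{t=1}^T [K/(2γ t) + 2 γ t (e_f t + z t · e_g t)] ≤ 4 √(K U ∑_{t=1}^T z t)`. -/
theorem adaptive_rate_telescoped_bound
    (T : ℕ) (hT : 0 < T) (K U : ℝ) (hK : 0 < K) (hU : 0 < U)
    (z ef eg : ℕ → ℝ)
    (hz : ∀ t ∈ Finset.Icc 1 T, 1 ≤ z t)
    (hef : ∀ t ∈ Finset.Icc 1 T, 0 ≤ ef t)
    (heg : ∀ t ∈ Finset.Icc 1 T, 0 ≤ eg t)
    (hefU : ∑ t ∈ Finset.Icc 1 T, ef t ≤ U)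
    (hegU : ∑ t ∈ Finset.Icc 1 T, eg t ≤ U)
    (γ : ℕ → ℝ)
    (hγ : ∀ t ∈ Finset.Icc 1 T,
      γ t = (1 / (2 * z t)) * Real.sqrt ((K / U) * ∑ τ ∈ Finset.Icc 1 t, z τ)) :
    ∑ t ∈ Finset.Icc 1 T, (K / (2 * γ t) + 2 * γ t * (ef t + z t * eg t)) ≤
      4 * Real.sqrt (K * U * ∑ t ∈ Finset.Icc 1 T, z t) := by
  have hz0 : ∀ t ∈ Finset.Icc 1 T, 0 ≤ z t := fun t ht => zero_le_one.trans (hz t ht)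
  have hc := Real.sqrt_pos.2 hK
  have hd := Real.sqrt_pos.2 hU
  have hc2 := Real.sq_sqrt hK.le
  have hd2 := Real.sq_sqrt hU.le
  set S : ℕ → ℝ := fun t => ∑ τ ∈ Finset.Icc 1 t, z τ
  have hterm : ∀ t ∈ Finset.Icc 1 T, K / (2 * γ t) + 2 * γ t * (ef t + z t * eg t) ≤
      √K * √U * (z t / √(S t)) + √K / √U * √(S T) * (ef t + eg t) := by
    intro t ht
    obtain ⟨h1, h2⟩ := Finset.mem_Icc.1 ht
    have hzt := hz t ht
    have hzpos : 0 < z t := by linarith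
    have hsub : Finset.Icc 1 t ⊆ Finset.Icc 1 T := Finset.Icc_subset_Icc_right h2
    have hSt : 0 < S t := hzpos.trans_le <|
      Finset.single_le_sum (fun i hi => hz0 i (hsub hi)) (Finset.mem_Icc.2 ⟨h1, le_rfl⟩)
    have hs := Real.sqrt_pos.2 hSt
    have hmono : √(S t) ≤ √(S T) := Real.sqrt_le_sqrt <|
      Finset.sum_le_sum_of_subset_of_nonneg hsub fun i hi _ => hz0 i hi
    have hγt : γ t = 1 / (2 * z t) * (√K / √U * √(S t)) := by
      rw [hγ t ht, Real.sqrt_mul (by positivity), Real.sqrt_div hK.le]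
    have hfirst : K / (2 * γ t) = √K * √U * (z t / √(S t)) := by
      rw [hγt]
      nth_rewrite 1 [← hc2]
      field_simp
    have hsecond : 2 * γ t * (ef t + z t * eg t) =
        √K / √U * √(S t) * (ef t / z t + eg t) := by
      rw [hγt]
      field_simp
    have he : ef t / z t ≤ ef t := div_le_self (hef t ht) hzt
    have hf := div_nonneg (hef t ht) hzpos.le
    have hg := heg t ht
    rw [hfirst, hsecond]
    gcongr
  have hsum := sum_div_sqrt_partialSum_le T z hz0
  calc
    _ ≤ ∑ t ∈ Finset.Icc 1 T,
        (√K * √U * (z t / √(S t)) + √K / √U * √(S T) * (ef t + eg t)) :=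
      Finset.sum_le_sum hterm
    _ = √K * √U * ∑ t ∈ Finset.Icc 1 T, z t / √(S t) + √K / √U * √(S T) *
        (∑ t ∈ Finset.Icc 1 T, ef t + ∑ t ∈ Finset.Icc 1 T, eg t) := by
      rw [Finset.sum_add_distrib, ← Finset.mul_sum, ← Finset.mul_sum, Finset.sum_add_distrib]
    _ ≤ √K * √U * (2 * √(S T)) + √K / √U * √(S T) * (√U ^ 2 + √U ^ 2) := by
      rw [hd2]
      gcongr
    _ = 4 * (√K * √U * √(S T)) := by
      field_simp
      ring
    _ = _ := by
      rw [Real.sqrt_mul (by positivity), Real.sqrt_mul hK.le]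
end

section
/- Let T be a positive integer and let K, U be real numbers with K ≥ 1 and 1 ≤ U ≤ T. Set V = √(K·T·U). Suppose q : {0, 1, …, T} → ℝ satisfies q(0) = 0 and q(t) ≥ 0 for all t, and r : {1, …, T} → ℝ satisfies r(t) ≥ −2t for all t, and for every t ∈ {1, …, T}: q(t)² + V·r(t) ≤ 4V·√(K·U·t) + 2t + 8√(K·U)·√(Σ_{τ=1}^{t} q(τ)²). Then r(T) ≤ 200·√K·T^{3/4}·U^{1/4}. -/
/-- A real `x ≥ 1` is the fourth power of `x ^ (1 / 4)`. -/
lemma exists_fourth_root {x : ℝ} (hx : 1 ≤ x) :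
    ∃ y : ℝ, 1 ≤ y ∧ y ^ 4 = x ∧ x ^ ((1 : ℝ) / 4) = y ∧ x ^ ((3 : ℝ) / 4) = y ^ 3 := by
  have h0 : 0 ≤ x := by linarith
  refine ⟨x ^ ((1 : ℝ) / 4), Real.one_le_rpow hx (by norm_num), ?_, rfl, ?_⟩
  · rw [← Real.rpow_natCast, ← Real.rpow_mul h0]; norm_num
  · rw [← Real.rpow_natCast, ← Real.rpow_mul h0]; norm_num

lemma sqrt_fourth_power (y : ℝ) : Real.sqrt (y ^ 4) = y ^ 2 := by
  rw [show y ^ 4 = (y ^ 2) ^ 2 by ring]; exact Real.sqrt_sq (sq_nonneg y)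


/-- Deterministic core of the regret bound for a feasible-in-expectation
benchmark (Theorem 1(a)): under the per-round regret decomposition inequality
with Lyapunov scaling `V = √(KTU)`, the regret satisfies
`r T ≤ 200 √K T^{3/4} U^{1/4}`. -/
theorem regret_bound_feasible_in_expectation
    (T : ℕ) (hT : 0 < T) (K U : ℝ) (hK : 1 ≤ K) (hU1 : 1 ≤ U) (hUT : U ≤ T)
    (V : ℝ) (hV : V = Real.sqrt (K * T * U))
    (q : ℕ → ℝ) (hq0 : q 0 = 0) (hq : ∀ t ≤ T, 0 ≤ q t)
    (r : ℕ → ℝ) (hr : ∀ t ∈ Finset.Icc 1 T, -(2 * (t : ℝ)) ≤ r t)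
    (hmain : ∀ t ∈ Finset.Icc 1 T,
      q t ^ 2 + V * r t ≤
        4 * V * Real.sqrt (K * U * t) + 2 * t +
          8 * Real.sqrt (K * U) * Real.sqrt (∑ τ ∈ Finset.Icc 1 t, q τ ^ 2)) :
    r T ≤ 200 * Real.sqrt K * (T : ℝ) ^ ((3 : ℝ) / 4) * U ^ ((1 : ℝ) / 4) := by
  have hT1 : (1 : ℝ) ≤ T := by exact_mod_cast hT
  obtain ⟨k, hk, hkK, -, -⟩ := exists_fourth_root hK
  obtain ⟨u, hu, huU, hU', -⟩ := exists_fourth_root hU1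
  obtain ⟨a, ha, haT, -, hT'⟩ := exists_fourth_root hT1
  have hua : u ≤ a := by
    refine le_of_pow_le_pow_left₀ (n := 4) (by norm_num) (by linarith) ?_
    rw [huU, haT]; exact hUT
  have hVeq : V = k ^ 2 * a ^ 2 * u ^ 2 := by
    rw [hV, ← hkK, ← haT, ← huU, ← mul_pow, ← mul_pow, sqrt_fourth_power]; ring
  have hKU : Real.sqrt (K * U) = k ^ 2 * u ^ 2 := by
    rw [← hkK, ← huU, ← mul_pow, sqrt_fourth_power]; ring
  have hKsqrt : Real.sqrt K = k ^ 2 := by rw [← hkK, sqrt_fourth_power]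
  rw [hKU] at hmain
  rw [hKsqrt, hT', hU']
  have hk0 : 0 < k := by linarith
  have hu0 : 0 < u := by linarith
  have ha0 : 0 < a := by linarith
  have hV0 : 0 < V := by rw [hVeq]; positivity
  have hKUt (t : ℕ) (ht : t ≤ T) : Real.sqrt (K * U * t) ≤ V := by
    rw [hV]
    apply Real.sqrt_le_sqrt
    have : (t : ℝ) ≤ T := by exact_mod_cast ht
    calc K * U * t ≤ K * U * T := by gcongr
      _ = K * T * U := by ring
  set S := ∑ τ ∈ Finset.Icc 1 T, q τ ^ 2 with hS
  have hS0 : 0 ≤ S := Finset.sum_nonneg fun _ _ => sq_nonneg _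
  set R := Real.sqrt S with hR
  have hR0 : 0 ≤ R := Real.sqrt_nonneg _
  have hRS : R ^ 2 = S := Real.sq_sqrt hS0
  have hq_le : ∀ t ∈ Finset.Icc 1 T,
      q t ^ 2 ≤ 2 * a ^ 4 * V + 4 * V ^ 2 + 2 * a ^ 4 + 8 * (k ^ 2 * u ^ 2) * R := by
    intro t ht
    have htT := (Finset.mem_Icc.mp ht).2
    have h1 := hmain t ht
    have h2 : V * -(2 * (t : ℝ)) ≤ V * r t := mul_le_mul_of_nonneg_left (hr t ht) hV0.le
    have h3 : V * Real.sqrt (K * U * t) ≤ V * V :=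
      mul_le_mul_of_nonneg_left (hKUt t htT) hV0.le
    have h4 : Real.sqrt (∑ τ ∈ Finset.Icc 1 t, q τ ^ 2) ≤ R :=
      Real.sqrt_le_sqrt (Finset.sum_le_sum_of_subset_of_nonneg
        (Finset.Icc_subset_Icc_right htT) fun _ _ _ => sq_nonneg _)
    have h5 := mul_le_mul_of_nonneg_left h4 (by positivity : 0 ≤ 8 * (k ^ 2 * u ^ 2))
    have h6 : (t : ℝ) ≤ a ^ 4 := by rw [haT]; exact_mod_cast htT
    have h7 := mul_le_mul_of_nonneg_left h6 hV0.le
    linarith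
  have hsum : R ^ 2 ≤
      a ^ 4 * (2 * a ^ 4 * V + 4 * V ^ 2 + 2 * a ^ 4 + 8 * (k ^ 2 * u ^ 2) * R) := by
    have h := Finset.sum_le_card_nsmul _ _ _ hq_le
    rw [Nat.card_Icc, Nat.add_sub_cancel, nsmul_eq_mul, ← haT] at h
    rw [hRS]; exact h
  set X := k ^ 2 * a ^ 5 * u with hX
  have hX0 : 0 < X := by positivity
  have hk4 : k ^ 2 ≤ k ^ 4 := pow_le_pow_right₀ hk (by norm_num)
  have hquad : R ^ 2 ≤ 8 * X ^ 2 + 8 * X * R := by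
    have e1 : a ^ 8 * V ≤ X ^ 2 := by
      calc a ^ 8 * V = k ^ 2 * (a ^ 10 * u ^ 2) := by rw [hVeq]; ring
        _ ≤ k ^ 4 * (a ^ 10 * u ^ 2) := by gcongr
        _ = X ^ 2 := by rw [hX]; ring
    have e2 : a ^ 4 * V ^ 2 ≤ X ^ 2 := by
      calc a ^ 4 * V ^ 2 = k ^ 4 * a ^ 8 * u ^ 2 * u ^ 2 := by rw [hVeq]; ring
        _ ≤ k ^ 4 * a ^ 8 * u ^ 2 * a ^ 2 := by gcongr
        _ = X ^ 2 := by rw [hX]; ring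
    have e3 : a ^ 8 ≤ a ^ 8 * V := by
      apply le_mul_of_one_le_right (by positivity)
      rw [hVeq, ← mul_pow, ← mul_pow]
      exact one_le_pow₀ (one_le_mul_of_one_le_of_one_le
        (one_le_mul_of_one_le_of_one_le hk ha) hu)
    have e4 : a ^ 4 * (k ^ 2 * u ^ 2) ≤ X := by
      calc a ^ 4 * (k ^ 2 * u ^ 2) = k ^ 2 * a ^ 4 * u * u := by ring
        _ ≤ k ^ 2 * a ^ 4 * u * a := by gcongr
        _ = X := by rw [hX]; ring
    have e5 := mul_le_mul_of_nonneg_right e4 hR0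
    linarith
  have hRX : R ≤ 9 * X := by
    by_contra! h
    nlinarith [mul_pos (sub_pos.mpr h) hX0]
  have hfinal : V * r T ≤ V * (200 * k ^ 2 * a ^ 3 * u) := by
    have h1 := hmain T (Finset.mem_Icc.mpr ⟨hT, le_rfl⟩)
    rw [← hS, ← hR, ← haT] at h1
    have h2 : V * Real.sqrt (K * U * a ^ 4) ≤ V * V := by
      rw [haT]; exact mul_le_mul_of_nonneg_left (hKUt T le_rfl) hV0.le
    have h3 : k ^ 2 * u ^ 2 * R ≤ V * (9 * (k ^ 2 * a ^ 3 * u)) := by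
      calc k ^ 2 * u ^ 2 * R ≤ k ^ 2 * u ^ 2 * (9 * X) := by gcongr
        _ = V * (9 * (k ^ 2 * a ^ 3 * u)) := by rw [hX, hVeq]; ring
    have h4 : V * V ≤ V * (k ^ 2 * a ^ 3 * u) := by
      apply mul_le_mul_of_nonneg_left _ hV0.le
      calc V = k ^ 2 * a ^ 2 * u * u := by rw [hVeq]; ring
        _ ≤ k ^ 2 * a ^ 2 * u * a := by gcongr
        _ = k ^ 2 * a ^ 3 * u := by ring
    have h5 : a ^ 4 ≤ V * (k ^ 2 * a ^ 3 * u) := by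
      calc a ^ 4 = 1 * a ^ 4 * 1 * 1 := by ring
        _ ≤ k ^ 4 * a ^ 5 * u ^ 3 * 1 := by
          gcongr
          · exact one_le_pow₀ hk
          · norm_num
          · exact one_le_pow₀ hu
        _ = V * (k ^ 2 * a ^ 3 * u) := by rw [hVeq]; ring
    have h6 := sq_nonneg (q T)
    have h7 : 0 ≤ V * (k ^ 2 * a ^ 3 * u) := by positivity
    linarith
  exact le_of_mul_le_mul_left hfinal hV0
end

section
/- Let T be a positive integer and let K, U be real numbers with K ≥ 1 and 1 ≤ U ≤ T. Set V = √(K·T·U). Suppose q : {0, 1, …, T} → ℝ satisfies q(0) = 0 and q(t) ≥ 0 for all t, and r : {1, …, T} → ℝ satisfies r(t) ≥ −2t for all t, and for every t ∈ {1, …, T}: q(t)² + V·r(t) ≤ 4V·√(K·U·t) + 2t + 8√(K·U)·√(Σ_{τ=1}^{t} q(τ)²). Then q(T) ≤ 200·√K·T^{3/4}·U^{1/4}. -/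
/-- Deterministic core of the CCV bound for a feasible-in-expectation
benchmark (Theorem 1(a)): under the per-round regret decomposition inequality
with Lyapunov scaling `V = √(KTU)`, the cumulative constraint violation
satisfies `q T ≤ 200 √K T^{3/4} U^{1/4}`. -/
theorem ccv_bound_feasible_in_expectation
    (T : ℕ) (hT : 0 < T) (K U : ℝ) (hK : 1 ≤ K) (hU1 : 1 ≤ U) (hUT : U ≤ T)
    (V : ℝ) (hV : V = Real.sqrt (K * T * U))
    (q : ℕ → ℝ) (hq0 : q 0 = 0) (hq : ∀ t ≤ T, 0 ≤ q t)
    (r : ℕ → ℝ) (hr : ∀ t ∈ Finset.Icc 1 T, -(2 * (t : ℝ)) ≤ r t)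
    (hmain : ∀ t ∈ Finset.Icc 1 T,
      q t ^ 2 + V * r t ≤
        4 * V * Real.sqrt (K * U * t) + 2 * t +
          8 * Real.sqrt (K * U) * Real.sqrt (∑ τ ∈ Finset.Icc 1 t, q τ ^ 2)) :
    q T ≤ 200 * Real.sqrt K * (T : ℝ) ^ ((3 : ℝ) / 4) * U ^ ((1 : ℝ) / 4) := by
  have hT1 : (1 : ℝ) ≤ T := by exact_mod_cast hT
  obtain ⟨k, hk⟩ : ∃ k, k = √K := ⟨_, rfl⟩
  obtain ⟨u, hu⟩ : ∃ u, u = √U := ⟨_, rfl⟩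
  obtain ⟨s, hs⟩ : ∃ s, s = √(T : ℝ) := ⟨_, rfl⟩
  have hk1 : 1 ≤ k := hk ▸ Real.one_le_sqrt.2 hK
  have hu1 : 1 ≤ u := hu ▸ Real.one_le_sqrt.2 hU1
  have hus : u ≤ s := by rw [hu, hs]; exact Real.sqrt_le_sqrt hUT
  have hs1 : 1 ≤ s := hu1.trans hus
  have hs2 : (T : ℝ) = s ^ 2 := by rw [hs, Real.sq_sqrt (by linarith)]
  have hA : √(K * U) = k * u := by rw [Real.sqrt_mul (by linarith), hk, hu]
  have hVs : V = k * s * u := by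
    rw [hV, Real.sqrt_mul (by positivity), Real.sqrt_mul (by linarith), hk, hu, hs]
  obtain ⟨B, hB⟩ : ∃ B, B = k ^ 2 * s ^ 3 * u := ⟨_, rfl⟩
  have hB0 : 0 < B := by rw [hB]; positivity
  have hAB : (k * u) ^ 2 * s ^ 2 ≤ B := by
    calc (k * u) ^ 2 * s ^ 2 = k ^ 2 * s ^ 2 * u * u := by ring
      _ ≤ k ^ 2 * s ^ 2 * u * s := by gcongr
      _ = B := by rw [hB]; ring
  have hVT : V * s ^ 2 ≤ B := by
    calc V * s ^ 2 = k * (s ^ 3 * u) := by rw [hVs]; ring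
      _ ≤ k ^ 2 * (s ^ 3 * u) := by gcongr; nlinarith
      _ = B := by rw [hB]; ring
  have hTB : s ^ 2 ≤ B := by
    refine le_trans ?_ hVT
    have hV1 : 1 ≤ V := by
      rw [hVs]; exact one_le_mul_of_one_le_of_one_le (one_le_mul_of_one_le_of_one_le hk1 hs1) hu1
    nlinarith [sq_nonneg s]
  have hV0 : 0 ≤ V := by rw [hVs]; positivity
  obtain ⟨R, hR⟩ : ∃ R, R = √(∑ τ ∈ Finset.Icc 1 T, q τ ^ 2) := ⟨_, rfl⟩
  have hR0 : 0 ≤ R := hR ▸ Real.sqrt_nonneg _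
  have hstep : ∀ t ∈ Finset.Icc 1 T, q t ^ 2 ≤ 8 * B + 8 * (k * u * R) := by
    intro t ht
    have htT : (t : ℝ) ≤ s ^ 2 := by
      rw [← hs2]; exact_mod_cast (Finset.mem_Icc.1 ht).2
    have h := hmain t ht
    have hreg : V * -(2 * s ^ 2) ≤ V * r t := by
      gcongr; linarith [hr t ht]
    have hsqrt : √(K * U * t) ≤ k * u * s := by
      rw [Real.sqrt_mul (by positivity), hA, hs]
      gcongr
      exact (Finset.mem_Icc.1 ht).2
    have hexp : V * √(K * U * t) ≤ B := by
      calc V * √(K * U * t) ≤ V * (k * u * s) := by gcongr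
        _ = (k * u) ^ 2 * s ^ 2 := by rw [hVs]; ring
        _ ≤ B := hAB
    have hsum : √(∑ τ ∈ Finset.Icc 1 t, q τ ^ 2) ≤ R := by
      rw [hR]
      refine Real.sqrt_le_sqrt (Finset.sum_le_sum_of_subset_of_nonneg ?_ ?_)
      · exact Finset.Icc_subset_Icc_right (Finset.mem_Icc.1 ht).2
      · exact fun _ _ _ => sq_nonneg _
    have hlast : k * u * √(∑ τ ∈ Finset.Icc 1 t, q τ ^ 2) ≤ k * u * R := by gcongr
    rw [hA] at h
    linarith
  have hRsq : R ^ 2 ≤ s ^ 2 * (8 * B + 8 * (k * u * R)) := by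
    rw [hR, Real.sq_sqrt (Finset.sum_nonneg fun _ _ => sq_nonneg _), ← hR, ← hs2]
    simpa [mul_add] using Finset.sum_le_card_nsmul _ _ _ hstep
  have hX0 : 0 ≤ k * u * R := by positivity
  have hX : (k * u * R) ^ 2 ≤ B * (8 * B + 8 * (k * u * R)) := by
    calc (k * u * R) ^ 2 = (k * u) ^ 2 * R ^ 2 := by ring
      _ ≤ (k * u) ^ 2 * (s ^ 2 * (8 * B + 8 * (k * u * R))) := by gcongr
      _ = (k * u) ^ 2 * s ^ 2 * (8 * B + 8 * (k * u * R)) := by ring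
      _ ≤ B * (8 * B + 8 * (k * u * R)) := by gcongr
  have hXB : k * u * R ≤ 10 * B := by
    by_contra! hlt
    nlinarith
  have hTpow : ((T : ℝ) ^ ((3 : ℝ) / 4)) ^ 2 = s ^ 3 := by
    rw [hs, Real.sqrt_eq_rpow, ← Real.rpow_mul_natCast (by positivity),
      ← Real.rpow_mul_natCast (by positivity)]
    norm_num
  have hUpow : (U ^ ((1 : ℝ) / 4)) ^ 2 = u := by
    rw [hu, Real.sqrt_eq_rpow, ← Real.rpow_mul_natCast (by positivity)]
    norm_num
  refine le_of_pow_le_pow_left₀ two_ne_zero (by positivity) ?_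
  rw [← hk, mul_pow, mul_pow, mul_pow, hTpow, hUpow]
  have hqT := hstep T (Finset.mem_Icc.2 ⟨hT, le_rfl⟩)
  linarith
end

section
/- Let T be a positive integer, and let K, U, ε be real numbers with K ≥ 1, 1 ≤ U ≤ T, K·U ≤ T, and ε > 0. Set V = √(K·T·U). Suppose q : {0, 1, …, T} → ℝ satisfies q(0) = 0 and q(t) ≥ 0 for all t, and r : {1, …, T} → ℝ satisfies r(t) ≥ −2t for all t, and for every t ∈ {1, …, T}: q(t)² + V·r(t) + 2ε·Σ_{τ=1}^{t−1} q(τ) ≤ 4V·√(K·U·t) + 2t + 8√(K·U)·√(Σ_{τ=1}^{t} q(τ)²). Then (1/T)·Σ_{τ=1}^{T−1} q(τ) ≤ 200·√(K·T·U)/ε. -/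
/-- A nonnegative solution of `R² ≤ 8 b² + 8 b R` with `b ≥ 0` satisfies `R ≤ 9 b`. -/
lemma le_nine_mul_of_sq_le {R b : ℝ} (hb : 0 ≤ b)
    (h : R ^ 2 ≤ 8 * b ^ 2 + 8 * b * R) : R ≤ 9 * b := by
  by_contra! hlt
  nlinarith [mul_nonneg hb (sub_nonneg.2 hlt.le), mul_pos (sub_pos.2 hlt) (sub_pos.2 hlt)]


/-- Deterministic core of the improved average CCV bound under Slater's
condition (Theorem 1(b)): under the strengthened per-round regret
decomposition inequality with Slater constant `ε > 0`, the average cumulative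
constraint violation satisfies `(1/T) ∑_{τ=1}^{T−1} q τ ≤ 200 √(KTU) / ε`. -/
theorem avg_ccv_bound_slater
    (T : ℕ) (hT : 0 < T) (K U ε : ℝ) (hK : 1 ≤ K) (hU1 : 1 ≤ U) (hUT : U ≤ T)
    (hKU : K * U ≤ T) (hε : 0 < ε)
    (V : ℝ) (hV : V = Real.sqrt (K * T * U))
    (q : ℕ → ℝ) (hq0 : q 0 = 0) (hq : ∀ t ≤ T, 0 ≤ q t)
    (r : ℕ → ℝ) (hr : ∀ t ∈ Finset.Icc 1 T, -(2 * (t : ℝ)) ≤ r t)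
    (hmain : ∀ t ∈ Finset.Icc 1 T,
      q t ^ 2 + V * r t + 2 * ε * (∑ τ ∈ Finset.Icc 1 (t - 1), q τ) ≤
        4 * V * Real.sqrt (K * U * t) + 2 * t +
          8 * Real.sqrt (K * U) * Real.sqrt (∑ τ ∈ Finset.Icc 1 t, q τ ^ 2)) :
    (1 / (T : ℝ)) * ∑ τ ∈ Finset.Icc 1 (T - 1), q τ ≤
      200 * Real.sqrt (K * T * U) / ε := by
  have hT1 : (1 : ℝ) ≤ T := by exact_mod_cast hT
  set a := Real.sqrt (K * U) with ha
  set s := Real.sqrt (T : ℝ) with hs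
  have hs2 : s ^ 2 = T := Real.sq_sqrt (by positivity)
  have ha1 : 1 ≤ a := Real.one_le_sqrt.2 (by nlinarith)
  have has : a ≤ s := Real.sqrt_le_sqrt hKU
  have hVas : V = a * s := by
    rw [hV, ha, hs, ← Real.sqrt_mul (by positivity)]
    congr 1
    ring
  have hV1 : 1 ≤ V := by rw [hVas]; nlinarith
  rw [← hV]
  set R := Real.sqrt (∑ τ ∈ Finset.Icc 1 T, q τ ^ 2) with hR
  have hR2 : R ^ 2 = ∑ τ ∈ Finset.Icc 1 T, q τ ^ 2 :=
    Real.sq_sqrt (Finset.sum_nonneg fun _ _ => sq_nonneg _)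
  have hround : ∀ t ∈ Finset.Icc 1 T,
      q t ^ 2 + 2 * ε * (∑ τ ∈ Finset.Icc 1 (t - 1), q τ) ≤ 8 * V * T + 8 * a * R := by
    intro t ht
    have htT : (t : ℝ) ≤ T := by exact_mod_cast (Finset.mem_Icc.1 ht).2
    have hRt : Real.sqrt (∑ τ ∈ Finset.Icc 1 t, q τ ^ 2) ≤ R :=
      Real.sqrt_le_sqrt (Finset.sum_le_sum_of_subset_of_nonneg
        (Finset.Icc_subset_Icc_right (Finset.mem_Icc.1 ht).2) fun _ _ _ => sq_nonneg _)
    have hsqrt : Real.sqrt (K * U * t) ≤ T := by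
      apply Real.sqrt_le_iff.2 ⟨by positivity, ?_⟩
      rw [sq]
      exact mul_le_mul hKU htT (by positivity) (by positivity)
    have h1 : V * Real.sqrt (K * U * t) ≤ V * T := by gcongr
    have h2 : a * Real.sqrt (∑ τ ∈ Finset.Icc 1 t, q τ ^ 2) ≤ a * R := by gcongr
    have h3 : V * -(2 * (t : ℝ)) ≤ V * r t :=
      mul_le_mul_of_nonneg_left (hr t ht) (by linarith)
    have h4 : V * t ≤ V * T := by gcongr
    have h5 : (T : ℝ) ≤ V * T := le_mul_of_one_le_left (by positivity) hV1
    linarith [hmain t ht]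
  have hsum : R ^ 2 ≤ T * (8 * V * T + 8 * a * R) := by
    have h := Finset.sum_le_card_nsmul (Finset.Icc 1 T) (fun t => q t ^ 2)
      (8 * V * T + 8 * a * R) fun t ht => by
        have hnn : 0 ≤ ∑ τ ∈ Finset.Icc 1 (t - 1), q τ := Finset.sum_nonneg fun τ hτ => hq τ <| by
          have := Finset.mem_Icc.1 hτ
          have := Finset.mem_Icc.1 ht
          omega
        have := mul_nonneg (mul_nonneg zero_le_two hε.le) hnn
        linarith [hround t ht]
    rw [hR2]
    simpa [mul_add] using h
  have hR0 : 0 ≤ R := Real.sqrt_nonneg _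
  have hR9 : R ≤ 9 * (s * T) := by
    apply le_nine_mul_of_sq_le (by positivity)
    have h1 : V ≤ s ^ 2 := by rw [hVas, sq]; gcongr
    have h2 : T * (8 * V * T + 8 * a * R) ≤ T * (8 * s ^ 2 * T + 8 * s * R) := by gcongr
    linarith
  have hfinal : 2 * ε * (∑ τ ∈ Finset.Icc 1 (T - 1), q τ) ≤ 80 * V * T := by
    have h1 : a * R ≤ a * (9 * (s * T)) := by gcongr
    have h2 : a * (9 * (s * T)) = 9 * V * T := by rw [hVas]; ring
    linarith [hround T (Finset.mem_Icc.2 ⟨hT, le_rfl⟩), sq_nonneg (q T)]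
  rw [one_div_mul_eq_div, div_le_div_iff₀ (by positivity) hε]
  have : 0 ≤ V * T := by positivity
  linarith
end

section
/- Let K, U, T be real numbers with K ≥ 1, U ≥ 1, T ≥ 1, and set λ = 1/(8√(K·U·T)). Let q ≥ 0 and r ≥ −T be real numbers satisfying exp(λq) − 1 + r ≤ 4√(K·U·T) + λ²·T·exp(λq) + 4λ·√(K·U·T)·exp(λq). Then r ≤ 4√(K·U·T) + 2/3 and q ≤ 8√(K·U·T)·ln(3·(1 + T + 4√(K·U·T))). -/
/-- Deterministic core of Theorem 1(c) (almost surely feasible benchmark):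
with the exponential Lyapunov function with rate `λ = 1/(8√(KUT))`, if
`exp(λq) − 1 + r ≤ 4√(KUT) + λ²T·exp(λq) + 4λ√(KUT)·exp(λq)`, then
`r ≤ 4√(KUT) + 2/3` and `q ≤ 8√(KUT)·ln(3(1 + T + 4√(KUT)))`. -/
theorem regret_ccv_bound_almost_sure
    (K U T : ℝ) (hK : 1 ≤ K) (hU : 1 ≤ U) (hT : 1 ≤ T)
    (lam : ℝ) (hlam : lam = 1 / (8 * Real.sqrt (K * U * T)))
    (q r : ℝ) (hq : 0 ≤ q) (hr : -T ≤ r)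
    (h : Real.exp (lam * q) - 1 + r ≤
      4 * Real.sqrt (K * U * T) + lam ^ 2 * T * Real.exp (lam * q) +
        4 * lam * Real.sqrt (K * U * T) * Real.exp (lam * q)) :
    r ≤ 4 * Real.sqrt (K * U * T) + 2 / 3 ∧
      q ≤ 8 * Real.sqrt (K * U * T) *
            Real.log (3 * (1 + T + 4 * Real.sqrt (K * U * T))) := by
  set s := Real.sqrt (K * U * T)
  have hKU : 1 ≤ K * U := one_le_mul_of_one_le_of_one_le hK hU
  have hTKUT : T ≤ K * U * T := le_mul_of_one_le_left (by linarith) hKU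
  have hs_sq : s ^ 2 = K * U * T := Real.sq_sqrt (by linarith)
  have hs_pos : 0 < s := Real.sqrt_pos.mpr (by linarith)
  have hlam_s : lam * s = 1 / 8 := by
    rw [hlam]
    field_simp
  have hlam_sq : lam ^ 2 * T ≤ 1 / 64 := by
    calc lam ^ 2 * T ≤ lam ^ 2 * s ^ 2 := by
          rw [hs_sq]
          gcongr
      _ = 1 / 64 := by
          rw [← mul_pow, hlam_s]
          norm_num
  have hlam_pos : 0 < lam := by
    rw [hlam]
    positivity
  have hexp : 1 ≤ Real.exp (lam * q) := Real.one_le_exp (by positivity)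
  have hquad : lam ^ 2 * T * Real.exp (lam * q) ≤ 1 / 64 * Real.exp (lam * q) := by
    gcongr
  have hlin : 4 * lam * s * Real.exp (lam * q) = 1 / 2 * Real.exp (lam * q) := by
    rw [mul_assoc 4 lam s, hlam_s]
    norm_num
  refine ⟨by linarith, ?_⟩
  have hlog : lam * q ≤ Real.log (3 * (1 + T + 4 * s)) :=
    (Real.le_log_iff_exp_le (by linarith)).mpr (by linarith)
  calc q = 8 * s * (lam * q) := by linear_combination -8 * q * hlam_s
    _ ≤ 8 * s * Real.log (3 * (1 + T + 4 * s)) := by gcongr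
end

section
/- Let K, U, T be real numbers with K ≥ 1, U ≥ 1, T ≥ 1, let B ≥ 0, and set λ = 1/(8√(K·U·T) + 2B). Let q ≥ 0 and r ≥ −T be real numbers satisfying exp(λq) − 1 + r ≤ 4√(K·U·T) + λ²·T·exp(λq) + λ·(4√(K·U·T) + B)·exp(λq). Then r ≤ 4√(K·U·T) + 2/3 and q ≤ (8√(K·U·T) + 2B)·ln(3·(1 + T + 4√(K·U·T))). -/
/-- Deterministic core of Theorem 1(d) (CBwK with total budget `B ≥ 0`): with
the exponential Lyapunov rate `λ = 1/(8√(KUT) + 2B)`, if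
`exp(λq) − 1 + r ≤ 4√(KUT) + λ²T·exp(λq) + λ(4√(KUT) + B)·exp(λq)`, then
`r ≤ 4√(KUT) + 2/3` and `q ≤ (8√(KUT) + 2B)·ln(3(1 + T + 4√(KUT)))`. -/
theorem regret_ccv_bound_cbwk
    (K U T B : ℝ) (hK : 1 ≤ K) (hU : 1 ≤ U) (hT : 1 ≤ T) (hB : 0 ≤ B)
    (lam : ℝ) (hlam : lam = 1 / (8 * Real.sqrt (K * U * T) + 2 * B))
    (q r : ℝ) (hq : 0 ≤ q) (hr : -T ≤ r)
    (h : Real.exp (lam * q) - 1 + r ≤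
      4 * Real.sqrt (K * U * T) + lam ^ 2 * T * Real.exp (lam * q) +
        lam * (4 * Real.sqrt (K * U * T) + B) * Real.exp (lam * q)) :
    r ≤ 4 * Real.sqrt (K * U * T) + 2 / 3 ∧
      q ≤ (8 * Real.sqrt (K * U * T) + 2 * B) *
            Real.log (3 * (1 + T + 4 * Real.sqrt (K * U * T))) := by
  have hKU : 1 ≤ K * U := one_le_mul_of_one_le_of_one_le hK hU
  have hTle : T ≤ K * U * T := le_mul_of_one_le_left (by linarith) hKU
  have hsq : Real.sqrt (K * U * T) ^ 2 = K * U * T := Real.sq_sqrt (by linarith)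
  have hs : 1 ≤ Real.sqrt (K * U * T) := Real.one_le_sqrt.2 (by linarith)
  set s := Real.sqrt (K * U * T)
  have hD : 0 < 8 * s + 2 * B := by linarith
  have hlamD : lam * (8 * s + 2 * B) = 1 := by
    rw [hlam]
    exact one_div_mul_cancel hD.ne'
  have hhalf : lam * (4 * s + B) = 1 / 2 := by linarith
  have hlamT : lam ^ 2 * T ≤ 1 / 6 := by
    have h_sq : lam ^ 2 * (8 * s + 2 * B) ^ 2 = 1 := by
      rw [← mul_pow, hlamD, one_pow]
    have h_le : 6 * T ≤ (8 * s + 2 * B) ^ 2 := by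
      nlinarith [mul_nonneg (by linarith : 0 ≤ s) hB, sq_nonneg B]
    linarith [mul_le_mul_of_nonneg_left h_le (sq_nonneg lam)]
  have hlam_nonneg : 0 ≤ lam := hlam ▸ (one_div_pos.2 hD).le
  have hexp : 1 ≤ Real.exp (lam * q) := Real.one_le_exp (mul_nonneg hlam_nonneg hq)
  have hmul : lam ^ 2 * T * Real.exp (lam * q) ≤ 1 / 6 * Real.exp (lam * q) :=
    mul_le_mul_of_nonneg_right hlamT (Real.exp_pos _).le
  rw [hhalf] at h
  refine ⟨by linarith, ?_⟩
  have hlog : lam * q ≤ Real.log (3 * (1 + T + 4 * s)) :=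
    (Real.le_log_iff_exp_le (by linarith)).2 (by linarith)
  calc q = (8 * s + 2 * B) * (lam * q) := by
        rw [← mul_assoc, mul_comm _ lam, hlamD, one_mul]
    _ ≤ _ := mul_le_mul_of_nonneg_left hlog hD.le
end

section
/- Let T be a positive integer and let K, U be real numbers with K ≥ 1 and U ≥ 1. Set V = √(K·U·T). Suppose q : {0, 1, …, T} → ℝ satisfies q(0) = 0 and q(t) ≥ 0 for all t, and r : {1, …, T} → ℝ satisfies Σ_{t=1}^{T} r(t) ≥ 0, and for every t ∈ {1, …, T}: q(t)² + V·r(t) ≤ 4V·√(K·U·t) + 2t + 8√(K·U)·√(Σ_{τ=1}^{t} q(τ)²). Then √(Σ_{t=1}^{T} q(t)²) ≤ 20·T·√(K·U) and r(T) ≤ 200·√(K·U·T). -/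
/-- A solution of the quadratic inequality `x ^ 2 ≤ a * x + b` is at most `a + √b`. -/
theorem le_add_sqrt_of_sq_le_mul_add {a b x : ℝ} (ha : 0 ≤ a) (hb : 0 ≤ b)
    (h : x ^ 2 ≤ a * x + b) : x ≤ a + √b := by
  by_contra! hx
  have hs := Real.sqrt_nonneg b
  nlinarith [Real.sq_sqrt hb, mul_nonneg ha hs]

/-- Deterministic core of Theorem 1(e) (sharper bounds under the non-negative
average regret assumption): with `V = √(KUT)` and `∑_{t=1}^T r t ≥ 0`, the
per-round regret decomposition inequality implies
`√(∑_{t=1}^T q t²) ≤ 20 T √(KU)` and `r T ≤ 200 √(KUT)`. -/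
theorem bound_nonneg_avg_regret
    (T : ℕ) (hT : 0 < T) (K U : ℝ) (hK : 1 ≤ K) (hU : 1 ≤ U)
    (V : ℝ) (hV : V = Real.sqrt (K * U * T))
    (q : ℕ → ℝ) (hq0 : q 0 = 0) (hq : ∀ t ≤ T, 0 ≤ q t)
    (r : ℕ → ℝ) (hrsum : 0 ≤ ∑ t ∈ Finset.Icc 1 T, r t)
    (hmain : ∀ t ∈ Finset.Icc 1 T,
      q t ^ 2 + V * r t ≤
        4 * V * Real.sqrt (K * U * t) + 2 * t +
          8 * Real.sqrt (K * U) * Real.sqrt (∑ τ ∈ Finset.Icc 1 t, q τ ^ 2)) :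
    Real.sqrt (∑ t ∈ Finset.Icc 1 T, q t ^ 2) ≤ 20 * T * Real.sqrt (K * U) ∧
      r T ≤ 200 * Real.sqrt (K * U * T) := by
  have hKU : 1 ≤ K * U := one_le_mul_of_one_le_of_one_le hK hU
  have hT1 : (1 : ℝ) ≤ T := by exact_mod_cast hT
  set S := √(K * U)
  have hS1 : 1 ≤ S := Real.one_le_sqrt.2 hKU
  have hSsq : S ^ 2 = K * U := Real.sq_sqrt (by linarith)
  have hVsq : V ^ 2 = S ^ 2 * T := by
    rw [hV, hSsq]
    exact Real.sq_sqrt (by positivity)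
  have hVpos : 0 < V := by
    rw [hV]
    exact Real.sqrt_pos.2 (by positivity)
  set R := √(∑ t ∈ Finset.Icc 1 T, q t ^ 2)
  have hRsq : R ^ 2 = ∑ t ∈ Finset.Icc 1 T, q t ^ 2 :=
    Real.sq_sqrt (Finset.sum_nonneg fun _ _ => sq_nonneg _)
  have hround : ∀ t ∈ Finset.Icc 1 T,
      q t ^ 2 + V * r t ≤ 4 * V ^ 2 + 2 * T + 8 * S * R := by
    intro t ht
    have htT : t ≤ T := (Finset.mem_Icc.1 ht).2
    have htT' : (t : ℝ) ≤ T := by exact_mod_cast htT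
    have hsqrt : √(K * U * t) ≤ V := by
      rw [hV]
      gcongr
    have hpartial : √(∑ τ ∈ Finset.Icc 1 t, q τ ^ 2) ≤ R :=
      Real.sqrt_le_sqrt (Finset.sum_le_sum_of_subset_of_nonneg
        (Finset.Icc_subset_Icc_right htT) fun _ _ _ => sq_nonneg _)
    calc q t ^ 2 + V * r t
        ≤ 4 * V * √(K * U * t) + 2 * t + 8 * S * √(∑ τ ∈ Finset.Icc 1 t, q τ ^ 2) := hmain t ht
      _ ≤ 4 * V * V + 2 * T + 8 * S * R := by gcongr
      _ = 4 * V ^ 2 + 2 * T + 8 * S * R := by ring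
  have hquad : R ^ 2 ≤ 8 * S * T * R + (3 * S * T) ^ 2 := by
    have hsum := Finset.sum_le_sum hround
    rw [Finset.sum_add_distrib, ← Finset.mul_sum, ← hRsq, Finset.sum_const, Nat.card_Icc,
      Nat.add_sub_cancel, nsmul_eq_mul, hVsq] at hsum
    have hdrop := mul_nonneg hVpos.le hrsum
    have hST : (T : ℝ) ^ 2 ≤ S ^ 2 * T ^ 2 :=
      le_mul_of_one_le_left (sq_nonneg _) (one_le_pow₀ hS1)
    nlinarith
  have hRle : R ≤ 20 * T * S := by
    have h := le_add_sqrt_of_sq_le_mul_add (by positivity) (sq_nonneg _) hquad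
    rw [Real.sqrt_sq (by positivity)] at h
    have hTS : 0 ≤ T * S := by positivity
    linarith
  refine ⟨hRle, ?_⟩
  rw [← hV]
  have hlast := hround T (Finset.mem_Icc.2 ⟨hT, le_rfl⟩)
  have hSR : S * R ≤ 20 * V ^ 2 := by
    calc S * R ≤ S * (20 * T * S) := by gcongr
      _ = 20 * V ^ 2 := by rw [hVsq]; ring
  have hTV : (T : ℝ) ≤ V ^ 2 := by
    rw [hVsq]
    exact le_mul_of_one_le_left (by positivity) (one_le_pow₀ hS1)
  refine le_of_mul_le_mul_left ?_ hVpos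
  linarith [sq_nonneg (q T), sq_nonneg V]
end
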